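/- Grid-optimized Gibbs posterior bound: let Λ ⊂ (0,+∞) be a finite set, and define λ̂ as a minimizer over λ ∈ Λ of E_{θ∼π_{−λr}}[r(θ)] + λC²/(8n) + ( KL(π_{−λr}‖π) + log(card(Λ)/ε) ) / λ, where π_{−λr} is the Gibbs posterior with density proportional to exp(−λ r(θ)) with respect to π; set ρ̂ = π_{−λ̂ r}. Then for any ε ∈ (0,1), with probability at least 1 − ε over the sample S: E_{θ∼ρ̂}[R(θ)] ≤ inf over ρ ∈ P(Θ) and λ ∈ Λ of ( E_{θ∼ρ}[r(θ)] + λC²/(8n) + ( KL(ρ‖π) + log(card(Λ)/ε) ) / λ ). -/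

import Mathlib

open MeasureTheory
open scoped ENNReal

/- Kullback-Leibler divergence: `∫ log (dρ/dπ) dρ` when `ρ ≪ π` (and the integral is
well-defined), `+∞` otherwise. -/
open Classical in
noncomputable def KL {Θ : Type*} [MeasurableSpace Θ] (ρ π : Measure Θ) : ℝ≥0∞ :=
  if ρ ≪ π ∧ Integrable (fun θ => Real.log ((ρ.rnDeriv π) θ).toReal) ρ
  then ENNReal.ofReal (∫ θ, Real.log ((ρ.rnDeriv π) θ).toReal ∂ρ)
  else ⊤

/- The risk `R(θ) = E_{(X,Y)∼P}[ℓ(f_θ(X),Y)]`. -/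
noncomputable def risk {X Y Θ : Type*} [MeasurableSpace X] [MeasurableSpace Y]
    (P : Measure (X × Y)) (f : Θ → X → Y) (ℓ : Y → Y → ℝ) (θ : Θ) : ℝ :=
  ∫ p, ℓ (f θ p.1) p.2 ∂P

/- The empirical risk `r(θ) = (1/n) ∑ᵢ ℓ(f_θ(Xᵢ),Yᵢ)` on the sample `ω`. -/
noncomputable def empRisk {X Y Θ : Type*} (f : Θ → X → Y) (ℓ : Y → Y → ℝ)
    (n : ℕ) (ω : Fin n → X × Y) (θ : Θ) : ℝ :=
  (∑ i, ℓ (f θ (ω i).1) (ω i).2) / n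

/- The Gibbs posterior `ρ̂_λ`, with density proportional to `exp (-λ r θ)` w.r.t. `π`. -/
noncomputable def gibbs {X Y Θ : Type*} [MeasurableSpace Θ] (π : Measure Θ)
    (f : Θ → X → Y) (ℓ : Y → Y → ℝ) (lam : ℝ) (n : ℕ) (ω : Fin n → X × Y) : Measure Θ :=
  π.tilted (fun θ => -lam * empRisk f ℓ n ω θ)

/- The empirical PAC-Bayes criterion `λ ↦ E_{θ∼π_{-λr}}[r(θ)] + λC²/(8n)
  + (KL(π_{-λr}‖π) + log(card(Λ)/ε))/λ` minimized over the grid. -/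
noncomputable def gridCriterion {X Y Θ : Type*} [MeasurableSpace Θ] (π : Measure Θ)
    (f : Θ → X → Y) (ℓ : Y → Y → ℝ) (C : ℝ) (n : ℕ) (M : ℕ) (ε : ℝ)
    (lam : ℝ) (ω : Fin n → X × Y) : ℝ≥0∞ :=
  (∫⁻ θ, ENNReal.ofReal (empRisk f ℓ n ω θ) ∂(gibbs π f ℓ lam n ω))
    + ENNReal.ofReal (lam * C ^ 2 / (8 * n))
    + (KL (gibbs π f ℓ lam n ω) π + ENNReal.ofReal (Real.log (M / ε)))
        / ENNReal.ofReal lam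

open ProbabilityTheory InformationTheory

/-- Gibbs' inequality for two probability measures. -/
lemma integral_llr_nonneg {Θ : Type*} [MeasurableSpace Θ] {ρ π : Measure Θ}
    [IsProbabilityMeasure ρ] [IsProbabilityMeasure π] (hac : ρ ≪ π) (hint : Integrable (llr ρ π) ρ) :
    0 ≤ ∫ θ, llr ρ π θ ∂ρ := by
  simpa using integral_llr_add_sub_measure_univ_nonneg hac hint

lemma KL_of_ac_of_integrable {Θ : Type*} [MeasurableSpace Θ] {ρ π : Measure Θ}
    (hac : ρ ≪ π) (hint : Integrable (llr ρ π) ρ) :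
    KL ρ π = ENNReal.ofReal (∫ θ, llr ρ π θ ∂ρ) :=
  if_pos ⟨hac, hint⟩

/-- The Donsker-Varadhan inequality. -/
lemma integral_le_integral_llr_add_log {Θ : Type*} [MeasurableSpace Θ] {ρ π : Measure Θ}
    [IsProbabilityMeasure ρ] [IsProbabilityMeasure π] (hac : ρ ≪ π) (hint : Integrable (llr ρ π) ρ)
    {g : Θ → ℝ} (hgρ : Integrable g ρ) (hgπ : Integrable (fun θ => Real.exp (g θ)) π) :
    ∫ θ, g θ ∂ρ ≤ ∫ θ, llr ρ π θ ∂ρ + Real.log (∫ θ, Real.exp (g θ) ∂π) := by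
  have := isProbabilityMeasure_tilted hgπ
  have h := integral_llr_nonneg (hac.trans (absolutelyContinuous_tilted hgπ))
    (integrable_llr_tilted_right hac hgρ hint hgπ)
  rw [integral_llr_tilted_right hac hgρ hgπ hint] at h
  linarith

lemma llr_tilted_self_ae_eq {Θ : Type*} [MeasurableSpace Θ] {π : Measure Θ}
    [IsProbabilityMeasure π] {g : Θ → ℝ} (hgπ : Integrable (fun θ => Real.exp (g θ)) π) :
    llr (π.tilted g) π =ᵐ[π.tilted g] fun θ => g θ - Real.log (∫ θ, Real.exp (g θ) ∂π) :=
  (tilted_absolutelyContinuous π g).ae_le (log_rnDeriv_tilted_left_self hgπ)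

lemma integral_llr_tilted_self {Θ : Type*} [MeasurableSpace Θ] {π : Measure Θ}
    [IsProbabilityMeasure π] {g : Θ → ℝ} (hgπ : Integrable (fun θ => Real.exp (g θ)) π)
    (hg : Integrable g (π.tilted g)) :
    ∫ θ, llr (π.tilted g) π θ ∂(π.tilted g)
      = ∫ θ, g θ ∂(π.tilted g) - Real.log (∫ θ, Real.exp (g θ) ∂π) := by
  have := isProbabilityMeasure_tilted hgπ
  rw [integral_congr_ae (llr_tilted_self_ae_eq hgπ), integral_sub hg (integrable_const _)]
  simp

/-- The PAC-Bayes objective as the image of a real number. -/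
lemma objective_eq_ofReal {Θ : Type*} [MeasurableSpace Θ] {ρ π : Measure Θ}
    [IsProbabilityMeasure ρ] [IsProbabilityMeasure π] (hac : ρ ≪ π) (hint : Integrable (llr ρ π) ρ)
    {b : Θ → ℝ} (hb : Integrable b ρ) (hb0 : ∀ θ, 0 ≤ b θ) {lam K L : ℝ} (hlam : 0 < lam)
    (hK : 0 ≤ K) (hL : 0 ≤ L) :
    (∫⁻ θ, ENNReal.ofReal (b θ) ∂ρ) + ENNReal.ofReal K
        + (KL ρ π + ENNReal.ofReal L) / ENNReal.ofReal lam
      = ENNReal.ofReal (∫ θ, b θ ∂ρ + K + (∫ θ, llr ρ π θ ∂ρ + L) / lam) := by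
  have h0 := integral_llr_nonneg hac hint
  have hbi : 0 ≤ ∫ θ, b θ ∂ρ := integral_nonneg hb0
  rw [KL_of_ac_of_integrable hac hint, ← ofReal_integral_eq_lintegral_ofReal hb (ae_of_all _ hb0),
    ← ENNReal.ofReal_add h0 hL, ← ENNReal.ofReal_div_of_pos hlam, ← ENNReal.ofReal_add hbi hK,
    ← ENNReal.ofReal_add (by positivity) (by positivity)]

lemma objective_eq_top {Θ : Type*} [MeasurableSpace Θ] {ρ π : Measure Θ}
    (h : ¬(ρ ≪ π ∧ Integrable (llr ρ π) ρ)) (A : ℝ≥0∞) (L lam : ℝ) :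
    A + (KL ρ π + ENNReal.ofReal L) / ENNReal.ofReal lam = ⊤ := by
  have : KL ρ π = ⊤ := if_neg h
  simp [this, ENNReal.top_div]

/-- The change-of-measure step: a bound on an exponential moment under `π` controls `∫ a ∂ρ`
for every `ρ`. -/
lemma lintegral_le_objective {Θ : Type*} [MeasurableSpace Θ] {ρ π : Measure Θ}
    [IsProbabilityMeasure ρ] [IsProbabilityMeasure π] {a b : Θ → ℝ} {C : ℝ}
    (ha : Measurable a) (hb : Measurable b) (haC : ∀ θ, a θ ∈ Set.Icc 0 C)
    (hbC : ∀ θ, b θ ∈ Set.Icc 0 C) {lam K L : ℝ} (hlam : 0 < lam) (hK : 0 ≤ K) (hL : 0 ≤ L)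
    (hexp : ∫⁻ θ, ENNReal.ofReal (Real.exp (lam * (a θ - b θ))) ∂π
      ≤ ENNReal.ofReal (Real.exp (lam * K + L))) :
    ∫⁻ θ, ENNReal.ofReal (a θ) ∂ρ ≤ (∫⁻ θ, ENNReal.ofReal (b θ) ∂ρ) + ENNReal.ofReal K
        + (KL ρ π + ENNReal.ofReal L) / ENNReal.ofReal lam := by
  by_cases h : ρ ≪ π ∧ Integrable (llr ρ π) ρ
  swap
  · rw [objective_eq_top h]; exact le_top
  obtain ⟨hac, hint⟩ := h
  have hia : Integrable a ρ := .of_mem_Icc 0 C ha.aemeasurable (ae_of_all _ haC)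
  have hib : Integrable b ρ := .of_mem_Icc 0 C hb.aemeasurable (ae_of_all _ hbC)
  have hiexp : Integrable (fun θ => Real.exp (lam * (a θ - b θ))) π :=
    integrable_exp_mul_of_mem_Icc (a := -C) (b := C) (ha.sub hb).aemeasurable
      (ae_of_all _ fun θ => ⟨by linarith [(haC θ).1, (hbC θ).2], by linarith [(haC θ).2, (hbC θ).1]⟩)
  rw [objective_eq_ofReal hac hint hib (fun θ => (hbC θ).1) hlam hK hL,
    ← ofReal_integral_eq_lintegral_ofReal hia (ae_of_all _ fun θ => (haC θ).1)]
  apply ENNReal.ofReal_le_ofReal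
  have hdv := integral_le_integral_llr_add_log hac hint ((hia.sub hib).const_mul lam) hiexp
  rw [← ofReal_integral_eq_lintegral_ofReal hiexp (ae_of_all _ fun θ => (Real.exp_pos _).le),
    ENNReal.ofReal_le_ofReal_iff (Real.exp_pos _).le] at hexp
  have hlog := (Real.log_le_iff_le_exp (integral_exp_pos hiexp)).2 hexp
  have hsub : ∫ θ, lam * (a - b) θ ∂ρ = lam * (∫ θ, a θ ∂ρ - ∫ θ, b θ ∂ρ) := by
    rw [integral_const_mul, integral_sub' hia hib]
  rw [hsub] at hdv
  have hle : lam * (∫ θ, a θ ∂ρ - ∫ θ, b θ ∂ρ) ≤ ∫ θ, llr ρ π θ ∂ρ + (lam * K + L) :=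
    hdv.trans (by gcongr; exact hlog)
  have : ∫ θ, a θ ∂ρ - ∫ θ, b θ ∂ρ - K ≤ (∫ θ, llr ρ π θ ∂ρ + L) / lam := by
    rw [le_div_iff₀ hlam]; linarith
  linarith

/-- The Gibbs measure minimizes the PAC-Bayes objective at fixed inverse temperature. -/
lemma objective_tilted_le {Θ : Type*} [MeasurableSpace Θ] {ρ π : Measure Θ}
    [IsProbabilityMeasure ρ] [IsProbabilityMeasure π] {b : Θ → ℝ} {C : ℝ}
    (hb : Measurable b) (hbC : ∀ θ, b θ ∈ Set.Icc 0 C) {lam K L : ℝ} (hlam : 0 < lam)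
    (hK : 0 ≤ K) (hL : 0 ≤ L) :
    (∫⁻ θ, ENNReal.ofReal (b θ) ∂(π.tilted fun θ => -lam * b θ)) + ENNReal.ofReal K
        + (KL (π.tilted fun θ => -lam * b θ) π + ENNReal.ofReal L) / ENNReal.ofReal lam
      ≤ (∫⁻ θ, ENNReal.ofReal (b θ) ∂ρ) + ENNReal.ofReal K
        + (KL ρ π + ENNReal.ofReal L) / ENNReal.ofReal lam := by
  by_cases h : ρ ≪ π ∧ Integrable (llr ρ π) ρ
  swap
  · rw [objective_eq_top h]; exact le_top
  obtain ⟨hac, hint⟩ := h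
  have hiexp : Integrable (fun θ => Real.exp (-lam * b θ)) π :=
    integrable_exp_mul_of_mem_Icc hb.aemeasurable (ae_of_all _ hbC)
  have := isProbabilityMeasure_tilted hiexp
  have hib (ν : Measure Θ) [IsProbabilityMeasure ν] : Integrable b ν :=
    .of_mem_Icc 0 C hb.aemeasurable (ae_of_all _ hbC)
  have hint' : Integrable (llr (π.tilted fun θ => -lam * b θ) π) (π.tilted fun θ => -lam * b θ) :=
    (integrable_congr (llr_tilted_self_ae_eq hiexp)).2
      (((hib _).const_mul _).sub (integrable_const _))
  rw [objective_eq_ofReal hac hint (hib ρ) (fun θ => (hbC θ).1) hlam hK hL,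
    objective_eq_ofReal (tilted_absolutelyContinuous π _) hint' (hib _) (fun θ => (hbC θ).1)
      hlam hK hL, integral_llr_tilted_self hiexp ((hib _).const_mul _)]
  apply ENNReal.ofReal_le_ofReal
  have hdv := integral_le_integral_llr_add_log hac hint ((hib ρ).const_mul (-lam)) hiexp
  rw [integral_const_mul] at hdv ⊢
  simp only [neg_mul] at hdv ⊢
  field_simp
  linarith

lemma empRisk_mem_Icc {X Y Θ : Type*} {f : Θ → X → Y} {ℓ : Y → Y → ℝ} {C : ℝ}
    (hbound : ∀ y' y : Y, ℓ y' y ∈ Set.Icc 0 C) {n : ℕ} (hn : 0 < n) (ω : Fin n → X × Y) (θ : Θ) :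
    empRisk f ℓ n ω θ ∈ Set.Icc 0 C := by
  have hn' : (0 : ℝ) < n := by exact_mod_cast hn
  refine ⟨div_nonneg (Finset.sum_nonneg fun i _ => (hbound _ _).1) hn'.le, ?_⟩
  rw [empRisk, div_le_iff₀ hn']
  calc ∑ i, ℓ (f θ (ω i).1) (ω i).2 ≤ ∑ _i : Fin n, C := Finset.sum_le_sum fun i _ => (hbound _ _).2
    _ = C * n := by simp [mul_comm]

lemma risk_mem_Icc {X Y Θ : Type*} [MeasurableSpace X] [MeasurableSpace Y] [MeasurableSpace Θ]
    {P : Measure (X × Y)} [IsProbabilityMeasure P] {f : Θ → X → Y} {ℓ : Y → Y → ℝ} {C : ℝ}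
    (hmeas : Measurable (fun p : Θ × X × Y => ℓ (f p.1 p.2.1) p.2.2))
    (hbound : ∀ y' y : Y, ℓ y' y ∈ Set.Icc 0 C) (θ : Θ) : risk P f ℓ θ ∈ Set.Icc 0 C := by
  refine ⟨integral_nonneg fun p => (hbound _ _).1, ?_⟩
  have hi : Integrable (fun p : X × Y => ℓ (f θ p.1) p.2) P :=
    .of_mem_Icc 0 C (hmeas.comp measurable_prodMk_left).aemeasurable
      (ae_of_all _ fun p => hbound _ _)
  simpa [risk] using integral_mono hi (integrable_const C) fun p => (hbound _ _).2

lemma measurable_risk {X Y Θ : Type*} [MeasurableSpace X] [MeasurableSpace Y] [MeasurableSpace Θ]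
    {P : Measure (X × Y)} [IsProbabilityMeasure P] {f : Θ → X → Y} {ℓ : Y → Y → ℝ}
    (hmeas : Measurable (fun p : Θ × X × Y => ℓ (f p.1 p.2.1) p.2.2)) :
    Measurable (risk P f ℓ) :=
  (hmeas.stronglyMeasurable.integral_prod_right' (ν := P)).measurable

lemma measurable_empRisk_uncurry {X Y Θ : Type*} [MeasurableSpace X] [MeasurableSpace Y]
    [MeasurableSpace Θ] {f : Θ → X → Y} {ℓ : Y → Y → ℝ}
    (hmeas : Measurable (fun p : Θ × X × Y => ℓ (f p.1 p.2.1) p.2.2)) (n : ℕ) :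
    Measurable (fun q : (Fin n → X × Y) × Θ => empRisk f ℓ n q.1 q.2) := by
  refine (Finset.measurable_sum _ fun i _ => ?_).div_const _
  exact hmeas.comp (measurable_snd.prodMk ((measurable_pi_apply i).comp measurable_fst))

/-- Hoeffding's bound on the exponential moment of the generalization gap of one predictor. -/
lemma lintegral_exp_risk_sub_empRisk_le {X Y Θ : Type*} [MeasurableSpace X] [MeasurableSpace Y]
    [MeasurableSpace Θ] {P : Measure (X × Y)} [IsProbabilityMeasure P]
    {f : Θ → X → Y} {ℓ : Y → Y → ℝ} {C : ℝ}
    (hmeas : Measurable (fun p : Θ × X × Y => ℓ (f p.1 p.2.1) p.2.2))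
    (hbound : ∀ y' y : Y, ℓ y' y ∈ Set.Icc 0 C) {n : ℕ} (hn : 0 < n) (lam : ℝ) (θ : Θ) :
    ∫⁻ ω, ENNReal.ofReal (Real.exp (lam * (risk P f ℓ θ - empRisk f ℓ n ω θ)))
        ∂(Measure.pi fun _ : Fin n => P)
      ≤ ENNReal.ofReal (Real.exp (lam * (lam * C ^ 2 / (8 * n)))) := by
  have hn' : (n : ℝ) ≠ 0 := by exact_mod_cast hn.ne'
  have hm : Measurable (fun p : X × Y => ℓ (f θ p.1) p.2) := hmeas.comp measurable_prodMk_left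
  have hsub : HasSubgaussianMGF (fun p : X × Y => ℓ (f θ p.1) p.2 - risk P f ℓ θ)
      ((‖C - 0‖₊ / 2) ^ 2) P :=
    hasSubgaussianMGF_of_mem_Icc hm.aemeasurable (ae_of_all _ fun p => hbound _ _)
  have hind : iIndepFun (fun (i : Fin n) (ω : Fin n → X × Y) =>
      ℓ (f θ (ω i).1) (ω i).2 - risk P f ℓ θ) (Measure.pi fun _ : Fin n => P) :=
    iIndepFun_pi fun _ => (hm.sub_const _).aemeasurable
  have hsum := HasSubgaussianMGF.sum_of_iIndepFun hind (s := Finset.univ)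
    (c := fun _ => (‖C - 0‖₊ / 2) ^ 2) fun i _ =>
      HasSubgaussianMGF.of_map (measurable_pi_apply i).aemeasurable
        (by rwa [(measurePreserving_eval (fun _ : Fin n => P) i).map_eq])
  have heq (ω : Fin n → X × Y) : lam * (risk P f ℓ θ - empRisk f ℓ n ω θ)
      = (-lam / n) * ∑ i, (ℓ (f θ (ω i).1) (ω i).2 - risk P f ℓ θ) := by
    simp only [empRisk, Finset.sum_sub_distrib, Finset.sum_const, Finset.card_univ,
      Fintype.card_fin, nsmul_eq_mul]
    field_simp
    ring
  simp_rw [heq]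
  rw [← ofReal_integral_eq_lintegral_ofReal (hsum.integrable_exp_mul _)
    (ae_of_all _ fun ω => (Real.exp_pos _).le)]
  refine ENNReal.ofReal_le_ofReal ((hsum.mgf_le (-lam / n)).trans_eq ?_)
  congr 1
  simp
  rw [div_pow, sq_abs]
  field_simp
  ring

/-- The exponential moment of the generalization gap, averaged over the prior, rarely exceeds
its Hoeffding bound by a factor `t`. -/
lemma measure_le_lintegral_exp_le {X Y Θ : Type*} [MeasurableSpace X] [MeasurableSpace Y]
    [MeasurableSpace Θ] {P : Measure (X × Y)} [IsProbabilityMeasure P]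
    {f : Θ → X → Y} {ℓ : Y → Y → ℝ} {C : ℝ}
    (hmeas : Measurable (fun p : Θ × X × Y => ℓ (f p.1 p.2.1) p.2.2))
    (hbound : ∀ y' y : Y, ℓ y' y ∈ Set.Icc 0 C) (π : Measure Θ) [IsProbabilityMeasure π]
    {n : ℕ} (hn : 0 < n) (lam : ℝ) {t : ℝ} (ht : 0 < t) :
    (Measure.pi fun _ : Fin n => P)
        {ω | ENNReal.ofReal (Real.exp (lam * (lam * C ^ 2 / (8 * n)) + Real.log t)) ≤
          ∫⁻ θ, ENNReal.ofReal (Real.exp (lam * (risk P f ℓ θ - empRisk f ℓ n ω θ))) ∂π}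
      ≤ ENNReal.ofReal t⁻¹ := by
  have hmexp : Measurable (fun q : (Fin n → X × Y) × Θ =>
      ENNReal.ofReal (Real.exp (lam * (risk P f ℓ q.2 - empRisk f ℓ n q.1 q.2)))) :=
    (((((measurable_risk hmeas).comp measurable_snd).sub
      (measurable_empRisk_uncurry hmeas n)).const_mul lam).exp).ennreal_ofReal
  refine (meas_ge_le_lintegral_div hmexp.lintegral_prod_right'.aemeasurable
    (by simp [Real.exp_pos]) ENNReal.ofReal_ne_top).trans ?_
  rw [lintegral_lintegral_swap hmexp.aemeasurable]
  refine ENNReal.div_le_of_le_mul ?_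
  rw [← ENNReal.ofReal_mul (by positivity), Real.exp_add, Real.exp_log ht]
  calc _ ≤ ∫⁻ _θ, ENNReal.ofReal (Real.exp (lam * (lam * C ^ 2 / (8 * n)))) ∂π :=
        lintegral_mono fun θ => lintegral_exp_risk_sub_empRisk_le hmeas hbound hn lam θ
    _ = _ := by
        rw [lintegral_const, measure_univ, mul_one]
        congr 1
        field_simp

/-- Grid-optimized Gibbs posterior bound: if `λ̂(ω)` minimizes the empirical PAC-Bayes
criterion over the finite grid `Λ ⊂ (0,∞)` and `ρ̂ = π_{-λ̂ r}`, then with probability at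
least `1 - ε`,
`E_{θ∼ρ̂}[R(θ)] ≤ inf_{ρ, λ∈Λ} ( E_{θ∼ρ}[r(θ)] + λC²/(8n) + (KL(ρ‖π) + log(card(Λ)/ε))/λ )`. -/
theorem grid_optimized_gibbs_pac_bayes_bound
    {X Y Θ : Type*} [MeasurableSpace X] [MeasurableSpace Y] [MeasurableSpace Θ]
    (P : Measure (X × Y)) [IsProbabilityMeasure P]
    (f : Θ → X → Y) (ℓ : Y → Y → ℝ) (C : ℝ) (hC : 0 < C)
    (hmeas : Measurable (fun p : Θ × X × Y => ℓ (f p.1 p.2.1) p.2.2))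
    (hbound : ∀ y' y : Y, ℓ y' y ∈ Set.Icc 0 C)
    (π : Measure Θ) [IsProbabilityMeasure π]
    (n : ℕ) (hn : 0 < n) (Λ : Finset ℝ) (hΛ : ∀ lam ∈ Λ, (0:ℝ) < lam)
    (ε : ℝ) (hε : ε ∈ Set.Ioo (0:ℝ) 1)
    (lamhat : (Fin n → X × Y) → ℝ)
    (hlamhat : ∀ ω, lamhat ω ∈ Λ ∧ ∀ lam ∈ Λ,
      gridCriterion π f ℓ C n Λ.card ε (lamhat ω) ω ≤ gridCriterion π f ℓ C n Λ.card ε lam ω) :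
    ENNReal.ofReal (1 - ε) ≤
      (Measure.pi fun _ : Fin n => P)
        {ω | ∫⁻ θ, ENNReal.ofReal (risk P f ℓ θ) ∂(gibbs π f ℓ (lamhat ω) n ω) ≤
          ⨅ ρ : {ρ : Measure Θ // IsProbabilityMeasure ρ}, ⨅ lam ∈ Λ,
            ((∫⁻ θ, ENNReal.ofReal (empRisk f ℓ n ω θ) ∂ρ.1)
              + ENNReal.ofReal (lam * C ^ 2 / (8 * n))
              + (KL ρ.1 π + ENNReal.ofReal (Real.log (Λ.card / ε)))
                  / ENNReal.ofReal lam)} := by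
  set μ := Measure.pi fun _ : Fin n => P
  have : Nonempty (X × Y) := nonempty_of_isProbabilityMeasure P
  have hcard : 0 < Λ.card := Finset.card_pos.2 ⟨_, (hlamhat fun _ => Classical.arbitrary _).1⟩
  have hcard' : (1 : ℝ) ≤ Λ.card := by exact_mod_cast hcard
  have ht : 0 < Λ.card / ε := by have := hε.1; positivity
  have hL : 0 ≤ Real.log (Λ.card / ε) :=
    Real.log_nonneg ((one_le_div hε.1).2 (hε.2.le.trans hcard'))
  set bad : ℝ → Set (Fin n → X × Y) := fun lam =>
    {ω | ENNReal.ofReal (Real.exp (lam * (lam * C ^ 2 / (8 * n)) + Real.log (Λ.card / ε))) ≤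
      ∫⁻ θ, ENNReal.ofReal (Real.exp (lam * (risk P f ℓ θ - empRisk f ℓ n ω θ))) ∂π}
    with hbad_def
  have hbad : μ (⋃ lam ∈ Λ, bad lam) ≤ ENNReal.ofReal ε := by
    calc μ (⋃ lam ∈ Λ, bad lam) ≤ ∑ lam ∈ Λ, μ (bad lam) := measure_biUnion_finset_le _ _
      _ ≤ ∑ _lam ∈ Λ, ENNReal.ofReal (Λ.card / ε)⁻¹ := Finset.sum_le_sum fun lam _ =>
          measure_le_lintegral_exp_le hmeas hbound π hn lam ht
      _ = ENNReal.ofReal ε := by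
          rw [Finset.sum_const, nsmul_eq_mul, ← ENNReal.ofReal_natCast,
            ← ENNReal.ofReal_mul (by positivity)]
          congr 1
          field_simp
  have hgood : ENNReal.ofReal (1 - ε) ≤ μ (⋃ lam ∈ Λ, bad lam)ᶜ := by
    rw [ENNReal.ofReal_sub _ hε.1.le, ENNReal.ofReal_one, tsub_le_iff_right]
    calc (1 : ℝ≥0∞) = μ Set.univ := measure_univ.symm
      _ ≤ μ (⋃ lam ∈ Λ, bad lam)ᶜ + μ (⋃ lam ∈ Λ, bad lam) := by
          rw [← Set.compl_union_self (⋃ lam ∈ Λ, bad lam)]; exact measure_union_le _ _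
      _ ≤ _ := by gcongr
  refine hgood.trans (measure_mono fun ω hω => ?_)
  simp only [Set.mem_compl_iff, Set.mem_iUnion, not_exists, hbad_def, Set.mem_ofPred_eq,
    not_le] at hω
  obtain ⟨hmem, hmin⟩ := hlamhat ω
  have hrm : Measurable (empRisk f ℓ n ω) :=
    (measurable_empRisk_uncurry hmeas n).comp measurable_prodMk_left
  have hrC := empRisk_mem_Icc (f := f) hbound hn ω
  have hK {lam : ℝ} (hlam : lam ∈ Λ) : 0 ≤ lam * C ^ 2 / (8 * n) := by
    have := hΛ lam hlam; positivity
  have : IsProbabilityMeasure (gibbs π f ℓ (lamhat ω) n ω) :=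
    isProbabilityMeasure_tilted
      (integrable_exp_mul_of_mem_Icc hrm.aemeasurable (ae_of_all _ hrC))
  rw [Set.mem_ofPred_eq]
  refine le_iInf fun ρ => le_iInf fun lam => le_iInf fun hlam => ?_
  have := ρ.2
  exact (lintegral_le_objective (measurable_risk hmeas) hrm (risk_mem_Icc hmeas hbound) hrC
    (hΛ _ hmem) (hK hmem) hL (hω _ hmem).le).trans
    ((hmin lam hlam).trans (objective_tilted_le hrm hrC (hΛ _ hlam) (hK hlam) hL))
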